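/- arXiv:1707.08269 — 2 statements merged into one kernel-verified Lean document; each statement's English description precedes it below -/
import Mathlib

section
/- Let μ be a σ-finite measure on a measurable space (Ω, 𝒜) and let h : Ω → [0, ∞) be a measurable function that is not μ-essentially bounded (i.e., for every C > 0 the set {ω : h(ω) > C} has positive μ-measure). Then there exists a measurable function g : Ω → [0, ∞) such that ∫_Ω log(1+g) dμ < ∞ while ∫_Ω log(1+g) · h dμ = ∞. -/
open MeasureTheory ENNReal NNReal

/-- If `h ≥ 0` is measurable and not `μ`-essentially bounded (every superlevel set
`{h > C}`, `C > 0`, has positive measure), then there is a measurable `g ≥ 0` with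
`∫ log(1+g) dμ < ∞` but `∫ log(1+g)·h dμ = ∞`. -/
theorem stmt2 {Ω : Type*} [MeasurableSpace Ω] (μ : Measure Ω) [SigmaFinite μ]
    (h : Ω → ℝ) (hmeas : Measurable h) (hnn : ∀ ω, 0 ≤ h ω)
    (hunbd : ∀ C : ℝ, 0 < C → 0 < μ {ω | C < h ω}) :
    ∃ g : Ω → ℝ, Measurable g ∧ (∀ ω, 0 ≤ g ω) ∧
      (∫⁻ ω, ENNReal.ofReal (Real.log (1 + g ω)) ∂μ) < ⊤ ∧
      (∫⁻ ω, ENNReal.ofReal (Real.log (1 + g ω) * h ω) ∂μ) = ⊤ := by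
  have hB : ∀ n : ℕ, ∃ t, MeasurableSet t ∧ t ⊆ {ω | (2:ℝ)^n < h ω} ∧ 0 < μ t ∧ μ t < ⊤ := fun n =>
    Measure.exists_subset_measure_lt_top (measurableSet_lt measurable_const hmeas)
      (hunbd _ (by positivity))
  choose B hBm hBs hB0 hBt using hB
  let c : ℕ → ℝ≥0∞ := fun n => (2⁻¹ : ℝ≥0∞)^n * (μ (B n))⁻¹
  let f : ℕ → Ω → ℝ≥0∞ := fun n => (B n).indicator (fun _ => c n)
  have hf : ∀ n, Measurable (f n) := fun n => measurable_const.indicator (hBm n)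
  let F : Ω → ℝ≥0∞ := fun ω => ∑' n, f n ω
  have hF : Measurable F := Measurable.ennreal_tsum hf
  have hc : ∀ n, c n * μ (B n) = (2⁻¹ : ℝ≥0∞)^n := fun n => by
    simp only [c]
    rw [mul_assoc, ENNReal.inv_mul_cancel (hB0 n).ne' (hBt n).ne, mul_one]
  have hFi : ∫⁻ ω, F ω ∂μ < ⊤ := by
    simp only [F]
    rw [lintegral_tsum (fun n => (hf n).aemeasurable)]
    simp only [f, lintegral_indicator_const (hBm _), hc]
    rw [ENNReal.tsum_geometric_two]
    exact ENNReal.ofNat_lt_top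
  have hFae : ∀ᵐ ω ∂μ, F ω < ⊤ := ae_lt_top hF hFi.ne
  have hlog : ∀ ω, Real.log (1 + (Real.exp (F ω).toReal - 1)) = (F ω).toReal := fun ω => by
    rw [add_sub_cancel, Real.log_exp]
  refine ⟨fun ω => Real.exp (F ω).toReal - 1, by fun_prop, fun ω => ?_, ?_, ?_⟩
  · have := Real.one_le_exp (ENNReal.toReal_nonneg (a := F ω))
    simp only
    linarith
  · simp only [hlog]
    exact (lintegral_mono fun ω => ENNReal.ofReal_toReal_le).trans_lt hFi
  · simp only [hlog]
    have e : ∫⁻ ω, ENNReal.ofReal ((F ω).toReal * h ω) ∂μ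
        = ∫⁻ ω, ∑' n, f n ω * ENNReal.ofReal (h ω) ∂μ := by
      refine lintegral_congr_ae ?_
      filter_upwards [hFae] with ω hω
      rw [ENNReal.ofReal_mul ENNReal.toReal_nonneg, ENNReal.ofReal_toReal hω.ne,
        ENNReal.tsum_mul_right]
    rw [e, lintegral_tsum (f := fun n ω => f n ω * ENNReal.ofReal (h ω)) (fun n => ((hf n).mul hmeas.ennreal_ofReal).aemeasurable), eq_top_iff,
      ← ENNReal.tsum_const_eq_top_of_ne_zero (α := ℕ) one_ne_zero]
    refine ENNReal.tsum_le_tsum fun n => ?_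
    calc (1 : ℝ≥0∞) = c n * 2^n * μ (B n) := by
          rw [mul_right_comm, hc, ← mul_pow, ENNReal.inv_mul_cancel (by simp) (by simp), one_pow]
      _ = ∫⁻ ω, (B n).indicator (fun _ => c n * 2^n) ω ∂μ :=
          (lintegral_indicator_const (hBm n) _).symm
      _ ≤ _ := by
          refine lintegral_mono fun ω => ?_
          by_cases hω : ω ∈ B n
          · simp only [f, Set.indicator_of_mem hω]
            gcongr
            have h1 : (2:ℝ)^n < h ω := hBs n hω
            have h2 := ENNReal.ofReal_le_ofReal h1.le
            rwa [ENNReal.ofReal_pow (by norm_num), ENNReal.ofReal_ofNat] at h2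
          · simp [hω]
end

section
/- Let μ and ν be σ-finite measures on measurable spaces (Ω₁, 𝒜₁) and (Ω₂, 𝒜₂), and let Φ be a ring isomorphism from the algebra of μ-a.e. equivalence classes of real-valued measurable functions on Ω₁ onto the algebra of ν-a.e. equivalence classes of real-valued measurable functions on Ω₂. Then Φ is order preserving: if f ≥ 0 μ-almost everywhere, then Φ(f) ≥ 0 ν-almost everywhere; consequently f ≤ g μ-a.e. implies Φ(f) ≤ Φ(g) ν-a.e. -/
open MeasureTheory

/-- A ring isomorphism (a bijection preserving addition and multiplication) between the
algebras `L⁰(μ, ℝ)` and `L⁰(ν, ℝ)` of a.e. equivalence classes of real-valued measurable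
functions is order preserving: it maps a.e. nonnegative classes to a.e. nonnegative
classes, and hence is monotone for the a.e. pointwise order. -/
theorem stmt5 {Ω₁ Ω₂ : Type*} [MeasurableSpace Ω₁] [MeasurableSpace Ω₂]
    (μ : Measure Ω₁) (ν : Measure Ω₂) [SigmaFinite μ] [SigmaFinite ν]
    (Φ : (Ω₁ →ₘ[μ] ℝ) → (Ω₂ →ₘ[ν] ℝ))
    (hbij : Function.Bijective Φ)
    (hadd : ∀ u v, Φ (u + v) = Φ u + Φ v)
    (hmul : ∀ u v, Φ (u * v) = Φ u * Φ v) :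
    (∀ u : Ω₁ →ₘ[μ] ℝ, 0 ≤ u → 0 ≤ Φ u) ∧
      ∀ u v : Ω₁ →ₘ[μ] ℝ, u ≤ v → Φ u ≤ Φ v := by
  have key : ∀ u : Ω₁ →ₘ[μ] ℝ, 0 ≤ u → 0 ≤ Φ u := by
    intro u hu
    have hs : u = AEEqFun.comp Real.sqrt Real.continuous_sqrt u *
        AEEqFun.comp Real.sqrt Real.continuous_sqrt u := by
      apply AEEqFun.ext
      have h0 := AEEqFun.coeFn_le.2 hu
      filter_upwards [h0, AEEqFun.coeFn_zero (α := Ω₁) (μ := μ) (β := ℝ),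
        AEEqFun.coeFn_comp Real.sqrt Real.continuous_sqrt u,
        AEEqFun.coeFn_mul (AEEqFun.comp Real.sqrt Real.continuous_sqrt u)
          (AEEqFun.comp Real.sqrt Real.continuous_sqrt u)] with x h1 h2 h3 h4
      rw [h2] at h1
      rw [h4, Pi.mul_apply, h3, Function.comp_apply, Real.mul_self_sqrt h1]
    rw [hs, hmul, ← AEEqFun.coeFn_le]
    generalize Φ _ = w
    filter_upwards [AEEqFun.coeFn_zero (α := Ω₂) (μ := ν) (β := ℝ),
      AEEqFun.coeFn_mul w w] with x h1 h2
    rw [h1, h2]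
    exact mul_self_nonneg (w x)
  refine ⟨key, fun u v huv => ?_⟩
  have hsub : 0 ≤ v - u := by
    rw [← AEEqFun.coeFn_le] at huv ⊢
    filter_upwards [huv, AEEqFun.coeFn_zero (α := Ω₁) (μ := μ) (β := ℝ),
      AEEqFun.coeFn_sub v u] with x h1 h2 h3
    rw [h2, h3]
    exact sub_nonneg.2 h1
  have h := key _ hsub
  have hv : Φ v = Φ (v - u) + Φ u := by rw [← hadd, sub_add_cancel]
  rw [hv]
  rw [← AEEqFun.coeFn_le] at h ⊢
  filter_upwards [h, AEEqFun.coeFn_zero (α := Ω₂) (μ := ν) (β := ℝ),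
    AEEqFun.coeFn_add (Φ (v - u)) (Φ u)] with x h1 h2 h3
  rw [h2] at h1
  rw [h3]
  exact le_add_of_nonneg_left h1
end
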